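/- In the free group F_2 = ⟨a,b⟩, the sequence G = (a, a⁻¹, b, b⁻¹, b⁻², ababa⁻²) satisfies condition (C2) but not condition (C1): the product a·(ababa⁻²)·b·b⁻²·a⁻¹·b⁻¹ lies in [F_2,F_2], yet for every n ≥ 1, no product of elements of G using each element exactly n times equals the identity. -/

import Mathlib

open scoped Classical

/-- The free group on two generators. -/
abbrev F2 := FreeGroup (Fin 2)

/-- The generator `a` of `F₂`. -/
def fa : F2 := FreeGroup.of 0

/-- The generator `b` of `F₂`. -/
def fb : F2 := FreeGroup.of 1

/-- The sequence `G = (a, a⁻¹, b, b⁻¹, b⁻², ababa⁻²)` in `F₂`. -/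
def Gseq : Fin 6 → F2 :=
  ![fa, fa⁻¹, fb, fb⁻¹, fb⁻¹ * fb⁻¹, fa * fb * fa * fb * fa⁻¹ * fa⁻¹]

/-- Reads a word in `F₂` from the right. It returns the sign of the last `b`-letter read
(`true` if there is none) and the `a`-exponent accumulated since then, where letters are inverted
because a group element is encoded by the word of its inverse. -/
def runState : List (Fin 2 × Bool) → Bool × ℤ
  | [] => (true, 0)
  | (0, e) :: L => ((runState L).1, (runState L).2 + if e then -1 else 1)
  | (1, e) :: _ => (!e, 0)

/-- The weight of a run `a^k` that follows a letter `b` (`s = true`) or `b⁻¹` (`s = false`). -/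
def runWeight (s : Bool) (k : ℤ) : ℤ :=
  if s then if k < 0 then -k else k % 2 else -(k % 2)

/-- The total weight of the `a`-runs of a word, read as in `runState`. -/
def wordWeight : List (Fin 2 × Bool) → ℤ
  | [] => 0
  | (0, e) :: L => wordWeight L + runWeight (runState L).1 ((runState L).2 + if e then -1 else 1)
      - runWeight (runState L).1 (runState L).2
  | (1, _) :: L => wordWeight L

/-- The state of the last `a`-run of `x`. -/
def lastRun (x : F2) : Bool × ℤ := runState x⁻¹.toWord

/-- The total weight of the `a`-runs of `x`. -/
def weight (x : F2) : ℤ := wordWeight x⁻¹.toWord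

lemma toWord_mk_singleton_mul (i : Fin 2) (e : Bool) (y : F2) :
    (FreeGroup.mk [(i, e)] * y).toWord = (i, e) :: y.toWord ∨
      y.toWord = (i, !e) :: (FreeGroup.mk [(i, e)] * y).toWord := by
  have h : (FreeGroup.mk [(i, e)] * y).toWord = FreeGroup.reduce ((i, e) :: y.toWord) := by
    conv_lhs => rw [← FreeGroup.mk_toWord (x := y), FreeGroup.mul_mk, FreeGroup.toWord_mk]
    rfl
  rw [h, FreeGroup.reduce.cons, FreeGroup.reduce_toWord]
  cases y.toWord with
  | nil => simp
  | cons p L =>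
    obtain ⟨j, f⟩ := p
    by_cases hc : i = j ∧ e = !f
    · obtain ⟨rfl, rfl⟩ := hc
      simp
    · simp [hc]

lemma inv_fa : fa⁻¹ = FreeGroup.mk [(0, false)] := rfl

lemma inv_fb : fb⁻¹ = FreeGroup.mk [(1, false)] := rfl

lemma lastRun_weight_mul_fa (x : F2) :
    lastRun (x * fa) = ((lastRun x).1, (lastRun x).2 + 1) ∧
      weight (x * fa) = weight x + runWeight (lastRun x).1 ((lastRun x).2 + 1)
        - runWeight (lastRun x).1 (lastRun x).2 := by
  unfold lastRun weight
  rw [mul_inv_rev, inv_fa]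
  rcases toWord_mk_singleton_mul 0 false x⁻¹ with h | h
  · simp [h, runState, wordWeight]
  · rw [h]
    simp [runState, wordWeight]

lemma lastRun_mul_fa (x : F2) : lastRun (x * fa) = ((lastRun x).1, (lastRun x).2 + 1) :=
  (lastRun_weight_mul_fa x).1

lemma weight_mul_fa (x : F2) :
    weight (x * fa) = weight x + runWeight (lastRun x).1 ((lastRun x).2 + 1)
      - runWeight (lastRun x).1 (lastRun x).2 :=
  (lastRun_weight_mul_fa x).2

lemma lastRun_mul_inv_fa (x : F2) :
    lastRun (x * fa⁻¹) = ((lastRun x).1, (lastRun x).2 - 1) := by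
  have h := lastRun_mul_fa (x * fa⁻¹)
  rw [inv_mul_cancel_right] at h
  simp [h]

lemma weight_mul_inv_fa (x : F2) :
    weight (x * fa⁻¹) = weight x + runWeight (lastRun x).1 ((lastRun x).2 - 1)
      - runWeight (lastRun x).1 (lastRun x).2 := by
  have h := weight_mul_fa (x * fa⁻¹)
  rw [inv_mul_cancel_right, lastRun_mul_inv_fa] at h
  simp only [sub_add_cancel] at h
  linarith

lemma weight_mul_fb (x : F2) : weight (x * fb) = weight x := by
  unfold weight
  rw [mul_inv_rev, inv_fb]
  rcases toWord_mk_singleton_mul 1 false x⁻¹ with h | h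
  · simp [h, wordWeight]
  · rw [h]
    simp [wordWeight]

lemma weight_mul_inv_fb (x : F2) : weight (x * fb⁻¹) = weight x := by
  rw [← weight_mul_fb (x * fb⁻¹), inv_mul_cancel_right]

lemma lastRun_mul_fb (x : F2) (hx : lastRun x ≠ (false, 0)) : lastRun (x * fb) = (true, 0) := by
  unfold lastRun at hx ⊢
  rw [mul_inv_rev, inv_fb]
  rcases toWord_mk_singleton_mul 1 false x⁻¹ with h | h
  · simp [h, runState]
  · rw [h] at hx
    simp [runState] at hx

lemma runWeight_add_one (s : Bool) (k : ℤ) :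
    runWeight s k - 1 ≤ runWeight s (k + 1) ∧ runWeight s (k + 1) ≤ runWeight s k + 1 := by
  cases s <;> simp only [runWeight, Bool.false_eq_true, if_true, if_false] <;>
    constructor <;> (try split_ifs) <;> omega

lemma runWeight_le_sub_two (s : Bool) (k : ℤ) : runWeight s k ≤ runWeight s (k - 1 - 1) := by
  cases s <;> simp only [runWeight, Bool.false_eq_true, if_true, if_false] <;>
    (try split_ifs) <;> omega

lemma weight_mul_word (x : F2) :
    weight x + 2 ≤ weight (x * fa * fb * fa * fb * fa⁻¹ * fa⁻¹) := by
  have h₁ := (runWeight_add_one (lastRun x).1 (lastRun x).2).1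
  have h₂ := (runWeight_add_one (lastRun (x * fa * fb)).1 (lastRun (x * fa * fb)).2).1
  have h₃ := runWeight_le_sub_two (lastRun (x * fa * fb * fa * fb)).1
    (lastRun (x * fa * fb * fa * fb)).2
  have w₁ : runWeight true 0 = 0 := by decide
  have w₂ : runWeight true 1 = 1 := by decide
  have w₃ : runWeight true (-1 - 1) = 2 := by decide
  have w₄ : runWeight false 0 = 0 := by decide
  have w₅ : runWeight false (-1) = -1 := by decide
  simp only [weight_mul_inv_fa, weight_mul_fb, weight_mul_fa, lastRun_mul_inv_fa]
  by_cases c₁ : lastRun (x * fa) = (false, 0)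
  · rw [lastRun_mul_fa, Prod.mk.injEq] at c₁
    have e₁ : (lastRun x).2 = -1 := by linarith
    rw [c₁.1, e₁] at h₁ ⊢
    by_cases c₂ : lastRun (x * fa * fb * fa) = (false, 0)
    · rw [lastRun_mul_fa, Prod.mk.injEq] at c₂
      have e₂ : (lastRun (x * fa * fb)).2 = -1 := by linarith
      rw [c₂.1, e₂] at h₂ ⊢
      norm_num at *
      linarith
    · have t := lastRun_mul_fb _ c₂
      rw [t]
      norm_num at *
      linarith
  · have t₁ := lastRun_mul_fb _ c₁
    have t₂ : lastRun (x * fa * fb * fa * fb) = (true, 0) :=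
      lastRun_mul_fb _ (by simp [lastRun_mul_fa, t₁])
    rw [t₁, t₂]
    norm_num at *
    linarith

/-- The guaranteed growth of `weight` under right multiplication by each element of `Gseq`. -/
def growth : Fin 6 → ℤ := ![-1, -1, 0, 0, 0, 2]

lemma weight_mul_Gseq (x : F2) (i : Fin 6) : weight x + growth i ≤ weight (x * Gseq i) := by
  have h₁ := (runWeight_add_one (lastRun x).1 (lastRun x).2).1
  have h₂ := (runWeight_add_one (lastRun x).1 ((lastRun x).2 - 1)).2
  rw [sub_add_cancel] at h₂
  fin_cases i
  · simp [growth, Gseq, weight_mul_fa]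
    linarith
  · simp [growth, Gseq, weight_mul_inv_fa]
    linarith
  · simp [growth, Gseq, weight_mul_fb]
  · simp [growth, Gseq, weight_mul_inv_fb]
  · simp [growth, Gseq, ← mul_assoc, weight_mul_inv_fb]
  · simpa [growth, Gseq, ← mul_assoc] using weight_mul_word x

lemma weight_mul_prod (x : F2) (L : List (Fin 6)) :
    weight x + (L.map growth).sum ≤ weight (x * (L.map Gseq).prod) := by
  induction L generalizing x with
  | nil => simp
  | cons i L ih =>
    have h₁ := weight_mul_Gseq x i
    have h₂ := ih (x * Gseq i)
    simp only [List.map_cons, List.sum_cons, List.prod_cons, ← mul_assoc]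
    linarith

lemma weight_one : weight 1 = 0 := by
  simp [weight, wordWeight]

lemma weight_Gseq_five : weight (Gseq 5) = 4 := by
  decide

lemma growth_sum_neg_of_prod_eq_one (L : List (Fin 6)) (hL : 5 ∈ L)
    (h : (L.map Gseq).prod = 1) : (L.map growth).sum < 0 := by
  obtain ⟨s, t, rfl⟩ := List.append_of_mem hL
  have hrot : Gseq 5 * ((t ++ s).map Gseq).prod = 1 := by
    simp only [List.map_append, List.map_cons, List.prod_append, List.prod_cons] at h ⊢
    rw [← mul_assoc]
    exact mul_eq_one_comm.mp h
  have hw := weight_mul_prod (Gseq 5) (t ++ s)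
  rw [hrot, weight_one, weight_Gseq_five] at hw
  have hg : growth 5 = 2 := rfl
  simp only [List.map_append, List.map_cons, List.sum_append, List.sum_cons] at hw ⊢
  linarith

open scoped commutatorElement in
lemma prod_Gseq_mem_commutator : (List.ofFn Gseq).prod ∈ commutator F2 := by
  have h : (List.ofFn Gseq).prod = fb⁻¹ * ⁅fb⁻¹, fa⁆ * fb⁻¹⁻¹ * ⁅fb⁻¹, fa * fa⁆ := by
    simp only [List.ofFn_succ, List.ofFn_zero, Gseq, commutatorElement_def]
    simp
    group
  have hc (x y : F2) : ⁅x, y⁆ ∈ commutator F2 :=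
    Subgroup.commutator_mem_commutator (Subgroup.mem_top x) (Subgroup.mem_top y)
  rw [h]
  exact mul_mem (Subgroup.Normal.conj_mem inferInstance _ (hc _ _) _) (hc _ _)

/-- the sequence `G = (a, a⁻¹, b, b⁻¹, b⁻², ababa⁻²)` in the free group
`F₂` satisfies condition (C2) — the product of its elements lies in `[F₂,F₂]` — but not
condition (C1): for every `n ≥ 1` and every `n`-to-1 map `σ : {1,...,6n} → {1,...,6}`,
the product `g_{σ(1)} ⋯ g_{σ(6n)}` is not the identity. -/
theorem free_group_C2_not_C1 :
    (List.ofFn Gseq).prod ∈ commutator F2 ∧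
      ∀ n : ℕ, 1 ≤ n → ∀ σ : Fin (n * 6) → Fin 6,
        (∀ i : Fin 6, (Finset.univ.filter fun j => σ j = i).card = n) →
        (List.ofFn fun j => Gseq (σ j)).prod ≠ 1 := by
  refine ⟨prod_Gseq_mem_commutator, fun n hn σ hσ h => ?_⟩
  have hmap {α : Type} (f : Fin 6 → α) : (List.ofFn σ).map f = List.ofFn fun j => f (σ j) :=
    List.map_ofFn ..
  have hmem : 5 ∈ List.ofFn σ := by
    obtain ⟨j, hj⟩ := Finset.card_pos.mp (hn.trans_eq (hσ 5).symm)
    exact List.mem_ofFn.mpr ⟨j, (Finset.mem_filter.mp hj).2⟩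
  have hneg := growth_sum_neg_of_prod_eq_one (List.ofFn σ) hmem (by rw [hmap, h])
  have hsum : ∑ j, growth (σ j) = ∑ i, n * growth i := by
    rw [← Finset.sum_fiberwise (s := Finset.univ) (g := σ)]
    refine Finset.sum_congr rfl fun i _ => ?_
    rw [Finset.sum_congr rfl fun j hj => congrArg growth (Finset.mem_filter.mp hj).2,
      Finset.sum_const, hσ, nsmul_eq_mul]
  rw [hmap, List.sum_ofFn, hsum, ← Finset.mul_sum] at hneg
  have hzero : ∑ i, growth i = 0 := by decide
  simp [hzero] at hneg
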